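/- arXiv:1506.05192 — 2 statements merged into one kernel-verified Lean document; each statement's English description precedes it below -/
import Mathlib

section
/- Let B = {(x,y) ∈ ℝ² : x² + y² ≤ 1} be the closed unit disk with two-dimensional Lebesgue measure, and let P ∈ ℂ[x,y] be homogeneous with ∫_B P(x,y)ᵐ dx dy = 0 for all sufficiently large m. Then for every Q ∈ ℂ[x,y], ∫_B P(x,y)ᵐ·Q(x,y) dx dy = 0 for all sufficiently large m. -/
open MeasureTheory

open Polynomial in
theorem exists_factorization_of_map_constantCoeff_eq_X_pow {K : Type*} [Field K]
    {F : (PowerSeries K)[X]} {k : ℕ} (hF : F.map PowerSeries.constantCoeff = X ^ k) :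
    ∃ a b : (PowerSeries K)[X], a.Monic ∧ a.natDegree = k ∧
      a.map PowerSeries.constantCoeff = X ^ k ∧ b.map PowerSeries.constantCoeff = 1 ∧
      F = a * b := by
  have hcomplete : IsAdicComplete (IsLocalRing.maximalIdeal (PowerSeries K)) (PowerSeries K) := by
    rw [PowerSeries.maximalIdeal_eq_span_X]; infer_instance
  have hmem (x : PowerSeries K) : x ∈ IsLocalRing.maximalIdeal (PowerSeries K) ↔
      PowerSeries.constantCoeff x = 0 := by
    rw [PowerSeries.maximalIdeal_eq_span_X, Ideal.mem_span_singleton, PowerSeries.X_dvd_iff]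
  have hres : (F : PowerSeries (PowerSeries K)).map (IsLocalRing.residue (PowerSeries K)) =
      PowerSeries.X ^ k := by
    ext i
    rw [PowerSeries.coeff_map, Polynomial.coeff_coe, PowerSeries.coeff_X_pow]
    have hi := congrArg (fun p => p.coeff i) hF
    simp only [coeff_map, coeff_X_pow] at hi
    split_ifs at hi ⊢ with h
    · rw [← map_one (IsLocalRing.residue (PowerSeries K)), ← sub_eq_zero, ← map_sub,
        IsLocalRing.residue_eq_zero_iff, hmem, map_sub, hi, map_one, sub_self]
    · rwa [IsLocalRing.residue_eq_zero_iff, hmem]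
  have hne : (F : PowerSeries (PowerSeries K)).map (IsLocalRing.residue (PowerSeries K)) ≠ 0 := by
    rw [hres]; exact pow_ne_zero _ PowerSeries.X_ne_zero
  obtain ⟨a, q, hq⟩ := PowerSeries.exists_isWeierstrassFactorization hne
  have hdeg : a.natDegree = k := by
    rw [hq.natDegree_eq_toNat_order_map, hres, PowerSeries.order_X_pow, ENat.toNat_natCast]
  have hmonic := hq.isDistinguishedAt.monic
  have hmap : a.map PowerSeries.constantCoeff = X ^ k := by
    ext i
    rw [coeff_map, coeff_X_pow]
    rcases lt_trichotomy i k with h | rfl | h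
    · rw [if_neg h.ne, ← hmem]
      exact hq.isDistinguishedAt.mem (hdeg ▸ h)
    · rw [if_pos rfl, ← hdeg, hmonic.coeff_natDegree, map_one]
    · rw [if_neg h.ne', coeff_eq_zero_of_natDegree_lt (hdeg ▸ h), map_zero]
  have hdiv := modByMonic_add_div F a
  have hmod : F %ₘ a = 0 := by
    have hdivisor := hq.isDistinguishedAt.isWeierstrassDivisorAt'
    have horder : ((a : PowerSeries (PowerSeries K)).map (Ideal.Quotient.mk
        (IsLocalRing.maximalIdeal (PowerSeries K)))).order.toNat = a.natDegree := by
      have h := congrArg ENat.toNat (hq.isDistinguishedAt.coe_natDegree_eq_order_map a 1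
        (by rw [map_one, ← Ideal.ne_top_iff_one]; exact Ideal.IsPrime.ne_top') (by simp))
      exact h.symm
    refine (hdivisor.eq_of_mul_add_eq_mul_add (q := ((F /ₘ a : (PowerSeries K)[X]) :
      PowerSeries (PowerSeries K))) (q' := q) (r := F %ₘ a) (r' := 0) ?_ ?_ ?_).2
    · rw [horder, ← degree_eq_natDegree hmonic.ne_zero]
      exact degree_modByMonic_lt _ hmonic
    · simp
    · rw [← Polynomial.coe_mul, ← Polynomial.coe_add, add_comm (a * (F /ₘ a)), hdiv,
        Polynomial.coe_zero, add_zero]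
      exact hq.eq_mul
  rw [hmod, zero_add] at hdiv
  refine ⟨a, F /ₘ a, hmonic, hdeg, hmap, ?_, hdiv.symm⟩
  have h := hF
  rw [← hdiv, Polynomial.map_mul, hmap] at h
  exact mul_left_cancel₀ (pow_ne_zero k X_ne_zero) (h.trans (mul_one _).symm)

theorem PowerSeries.derivative_map {R S : Type*} [CommSemiring R] [CommSemiring S] (φ : R →+* S)
    (f : PowerSeries R) :
    derivative S (f.map φ) = (derivative R f).map φ := by
  ext n
  simp [coeff_derivative]

theorem LaurentPolynomial.coeff_toLaurent_natCast {R : Type*} [Semiring R] (p : Polynomial R)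
    (n : ℕ) :
    (Polynomial.toLaurent p).coeff n = p.coeff n := by
  rw [coeff_toLaurent]
  exact Finsupp.mapDomain_apply Nat.castEmbedding.injective _ n

open LaurentPolynomial in
theorem map_constantCoeff_eq_one_of_laurent_factorization {K : Type*} [Field K] [CharZero K]
    {f : K[T;T⁻¹]} {u v : PowerSeries (Polynomial K)}
    (huv : u.map ((invert : K[T;T⁻¹] ≃ₐ[K] K[T;T⁻¹]).toRingEquiv.toRingHom.comp
      Polynomial.toLaurent) * v.map Polynomial.toLaurent = 1 - PowerSeries.X * PowerSeries.C f)
    (hu : u.constantCoeff = 1) (hv : v.constantCoeff = 1)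
    (hu0 : u.map Polynomial.constantCoeff = 1)
    (hf : ∀ m : ℕ, 1 ≤ m → (f ^ m).coeff 0 = 0) :
    v.map Polynomial.constantCoeff = 1 := by
  set ψ : Polynomial K →+* K[T;T⁻¹] :=
    (invert : K[T;T⁻¹] ≃ₐ[K] K[T;T⁻¹]).toRingEquiv.toRingHom.comp Polynomial.toLaurent with hψ
  have hι0 (p : Polynomial K) : (Polynomial.toLaurent p).coeff 0 = Polynomial.constantCoeff p :=
    coeff_toLaurent_natCast p 0
  have hψ0 (p : Polynomial K) : (ψ p).coeff 0 = Polynomial.constantCoeff p := by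
    rw [← hι0]
    exact (invert_apply _ 0).trans (by rw [neg_zero])
  obtain ⟨u', hu'⟩ := (PowerSeries.isUnit_iff_constantCoeff.mpr (hu ▸ isUnit_one)).exists_right_inv
  obtain ⟨v', hv'⟩ := (PowerSeries.isUnit_iff_constantCoeff.mpr (hv ▸ isUnit_one)).exists_right_inv
  set E : PowerSeries K[T;T⁻¹] := PowerSeries.mk fun m => f ^ m with hE
  have hEinv : (1 - PowerSeries.X * PowerSeries.C f) * E = 1 := by
    ext n : 1
    rw [sub_mul, one_mul, mul_assoc]
    cases n with
    | zero => simp [hE]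
    | succ n =>
      simp [hE, PowerSeries.coeff_succ_X_mul, PowerSeries.coeff_one, pow_succ']
  have hder := congrArg (PowerSeries.derivative K[T;T⁻¹]) huv
  simp only [Derivation.leibniz, map_sub, PowerSeries.derivative_one, PowerSeries.derivative_X,
    PowerSeries.derivative_C, PowerSeries.derivative_map, smul_eq_mul, mul_zero, mul_one,
    zero_add, zero_sub] at hder
  have hu'' : u.map ψ * u'.map ψ = 1 := by rw [← map_mul, hu', map_one]
  have hv'' : v.map Polynomial.toLaurent * v'.map Polynomial.toLaurent = 1 := by
    rw [← map_mul, hv', map_one]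
  have key : (PowerSeries.derivative _ v * v').map Polynomial.toLaurent +
      (PowerSeries.derivative _ u * u').map ψ = - (PowerSeries.C f * E) := by
    rw [map_mul, map_mul]
    rw [← huv] at hEinv
    linear_combination (E * u'.map ψ * 0 + E) * hder
      - (PowerSeries.map Polynomial.toLaurent (PowerSeries.derivative _ v) *
          v'.map Polynomial.toLaurent * hEinv)
      - (PowerSeries.map ψ (PowerSeries.derivative _ u) * u'.map ψ * hEinv)
      + (PowerSeries.map Polynomial.toLaurent (PowerSeries.derivative _ v) * u.map ψ * E * hv'')
      + (PowerSeries.map ψ (PowerSeries.derivative _ u) * v.map Polynomial.toLaurent * E * hu'')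
  have hcoeff : (PowerSeries.derivative _ v * v').map Polynomial.constantCoeff = 0 := by
    ext n
    have h := congrArg (fun p => (PowerSeries.coeff n p).coeff 0) key
    have hun : Polynomial.constantCoeff (PowerSeries.coeff n (PowerSeries.derivative _ u * u')) =
        0 := by
      rw [← PowerSeries.coeff_map, map_mul, ← PowerSeries.derivative_map, hu0,
        PowerSeries.derivative_one, zero_mul, map_zero]
    simp only [map_add, PowerSeries.coeff_map, map_neg, PowerSeries.coeff_C_mul, hE,
      PowerSeries.coeff_mk, ← pow_succ', AddMonoidAlgebra.coeff_add, AddMonoidAlgebra.coeff_neg,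
      Finsupp.add_apply, Finsupp.neg_apply, hι0, hψ0, hun, hf (n + 1) (by omega)] at h
    rw [PowerSeries.coeff_map]
    simpa using h
  refine PowerSeries.derivative.ext ?_ ?_
  · rw [PowerSeries.derivative_one, PowerSeries.derivative_map]
    have h := congrArg (· * v.map Polynomial.constantCoeff) hcoeff
    simp only [← map_mul, mul_assoc, mul_comm v' v, hv', mul_one, zero_mul] at h
    exact h
  · rw [map_one, ← PowerSeries.coeff_zero_eq_constantCoeff_apply, PowerSeries.coeff_map,
      PowerSeries.coeff_zero_eq_constantCoeff_apply, hv, map_one]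

theorem LaurentPolynomial.coeff_zero_pow_T_neg_mul_toLaurent {K : Type*} [CommRing K]
    (g : Polynomial K) (k m : ℕ) :
    ((LaurentPolynomial.T (-(k : ℤ)) * Polynomial.toLaurent g) ^ m).coeff 0 =
      (g ^ m).coeff (k * m) := by
  rw [mul_pow, T_pow, ← map_pow, T, AddMonoidAlgebra.coeff_single_mul_apply, one_mul,
    ← coeff_toLaurent_natCast]
  congr 1
  push_cast
  ring

open Polynomial in
theorem coeff_zero_eq_one_of_eq_mul {K : Type*} [Field K] [CharZero K] {g : K[X]} {k : ℕ}
    (hg : ∀ m : ℕ, 1 ≤ m → (g ^ m).coeff (k * m) = 0) {a b : (PowerSeries K)[X]}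
    (ha : a.Monic) (hdeg : a.natDegree = k) (hamap : a.map PowerSeries.constantCoeff = X ^ k)
    (hbmap : b.map PowerSeries.constantCoeff = 1)
    (hab : X ^ k - C PowerSeries.X * g.map PowerSeries.C = a * b) : b.coeff 0 = 1 := by
  set σ : (PowerSeries K)[X] →+* PowerSeries K[X] :=
    eval₂RingHom (PowerSeries.map C) (PowerSeries.C X) with hσ
  have hconst (p : (PowerSeries K)[X]) :
      (σ p).constantCoeff = p.map PowerSeries.constantCoeff := by
    have h : PowerSeries.constantCoeff.comp σ = mapRingHom PowerSeries.constantCoeff := by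
      apply ringHom_ext
      · intro r
        simp only [hσ, RingHom.comp_apply, coe_eval₂RingHom, eval₂_C, coe_mapRingHom, map_C]
        rw [← PowerSeries.coeff_zero_eq_constantCoeff_apply, PowerSeries.coeff_map,
          PowerSeries.coeff_zero_eq_constantCoeff_apply]
      · simp [hσ]
    exact congrArg (fun φ => φ p) h
  have hzero (p : (PowerSeries K)[X]) :
      (σ p).map Polynomial.constantCoeff = p.coeff 0 := by
    have h : (PowerSeries.map Polynomial.constantCoeff).comp σ = Polynomial.constantCoeff := by
      apply ringHom_ext
      · intro r
        ext n
        simp [hσ]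
      · simp [hσ]
    exact congrArg (fun φ => φ p) h
  set ψ : K[X] →+* LaurentPolynomial K := (LaurentPolynomial.invert :
    LaurentPolynomial K ≃ₐ[K] LaurentPolynomial K).toRingEquiv.toRingHom.comp toLaurent with hψ
  have hι (p : (PowerSeries K)[X]) : (σ p).map toLaurent =
      eval₂ (PowerSeries.map LaurentPolynomial.C) (PowerSeries.C (LaurentPolynomial.T 1)) p := by
    have h : (PowerSeries.map toLaurent).comp σ = eval₂RingHom
        (PowerSeries.map LaurentPolynomial.C) (PowerSeries.C (LaurentPolynomial.T 1)) := by
      apply ringHom_ext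
      · intro r
        ext n : 1
        simp [hσ]
      · simp [hσ]
    exact congrArg (fun φ => φ p) h
  have hψσ (p : (PowerSeries K)[X]) : (σ p).map ψ = eval₂ (PowerSeries.map LaurentPolynomial.C)
      (PowerSeries.C (LaurentPolynomial.T (-1))) p := by
    have h : (PowerSeries.map ψ).comp σ = eval₂RingHom
        (PowerSeries.map LaurentPolynomial.C) (PowerSeries.C (LaurentPolynomial.T (-1))) := by
      apply ringHom_ext
      · intro r
        ext n : 1
        simp [hσ, hψ]
      · simp [hσ, hψ]
    exact congrArg (fun φ => φ p) h
  have harev : a.reverse.map PowerSeries.constantCoeff = 1 := by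
    rw [reverse, ← reflect_map, hamap, hdeg, reflect_monomial, revAt_le le_rfl, Nat.sub_self,
      pow_zero]
  have hT : (PowerSeries.C (LaurentPolynomial.T (R := K) (-1))) *
      PowerSeries.C (LaurentPolynomial.T (R := K) 1) = 1 := by
    rw [← map_mul, ← LaurentPolynomial.T_add]
    simp
  let hinv : Invertible (PowerSeries.C (LaurentPolynomial.T (R := K) 1)) :=
    ⟨PowerSeries.C (LaurentPolynomial.T (-1)), hT, by rw [mul_comm, hT]⟩
  have hrev := eval₂_reverse_mul_pow (PowerSeries.map (LaurentPolynomial.C (R := K)))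
    (PowerSeries.C (LaurentPolynomial.T 1)) a
  change eval₂ _ (PowerSeries.C (LaurentPolynomial.T (-1))) _ * _ = _ at hrev
  rw [← hψσ, ← hι, hdeg] at hrev
  have hprod := congrArg (fun p => (σ p).map toLaurent) hab
  simp only [map_mul, map_sub, map_pow] at hprod
  have hX : (σ X).map toLaurent = PowerSeries.C (LaurentPolynomial.T (R := K) 1) := by
    rw [hι, eval₂_X]
  have hCX : (σ (C PowerSeries.X)).map toLaurent =
      (PowerSeries.X : PowerSeries (LaurentPolynomial K)) := by
    rw [hι, eval₂_C, PowerSeries.map_X]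
  have hgσ : (σ (g.map PowerSeries.C)).map toLaurent = PowerSeries.C (toLaurent g) := by
    rw [hι, eval₂_map]
    have h : eval₂RingHom ((PowerSeries.map LaurentPolynomial.C).comp PowerSeries.C)
        (PowerSeries.C (LaurentPolynomial.T (R := K) 1)) = PowerSeries.C.comp toLaurent := by
      apply ringHom_ext
      · intro r
        simp
      · simp
    exact congrArg (fun φ => φ g) h
  rw [hX, hCX, hgσ, ← hrev] at hprod
  have hTk : PowerSeries.C (LaurentPolynomial.T (R := K) (-(k : ℤ))) *
      PowerSeries.C (LaurentPolynomial.T 1) ^ k = 1 := by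
    rw [← map_pow, ← map_mul, LaurentPolynomial.T_pow, ← LaurentPolynomial.T_add]
    simp
  have huv : (σ a.reverse).map ψ * (σ b).map toLaurent =
      1 - PowerSeries.X * PowerSeries.C (LaurentPolynomial.T (-(k : ℤ)) * toLaurent g) := by
    rw [map_mul]
    linear_combination (-PowerSeries.C (LaurentPolynomial.T (R := K) (-(k : ℤ)))) * hprod +
      (1 - (σ a.reverse).map ψ * (σ b).map toLaurent) * hTk
  rw [← hzero]
  refine map_constantCoeff_eq_one_of_laurent_factorization huv ?_ ?_ ?_ fun m hm => ?_
  · rw [hconst, harev]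
  · rw [hconst, hbmap]
  · rw [hzero, coeff_zero_reverse, ha.leadingCoeff]
  · rw [LaurentPolynomial.coeff_zero_pow_T_neg_mul_toLaurent, hg m hm]

open Polynomial IntermediateField in
theorem exists_pow_eq_pow_of_multiset_prod_eq_algebraMap {F L : Type*} [Field F] [Field L]
    [Algebra F L] {h : F[X]} (hirr : Irreducible h) {S : Multiset L}
    (hS : ∀ x ∈ S, aeval x h = 0) {u : F} (hu : S.prod = algebraMap F L u) (hne : S ≠ 0) :
    ∃ e : ℕ, 0 < e ∧ u ^ (h.natDegree * e) =
      ((-1) ^ h.natDegree * (h.coeff 0 / h.leadingCoeff)) ^ (e * S.card) := by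
  classical
  have hint (x : L) (hx : x ∈ S) : IsIntegral F x :=
    (show IsAlgebraic F x from ⟨h, hirr.ne_zero, hS x hx⟩).isIntegral
  set E := IntermediateField.adjoin F {x | x ∈ S} with hE
  have hfin : Finite {x | x ∈ S} := by
    have : {x | x ∈ S} = (S.toFinset : Set L) := by ext; simp
    rw [this]; infer_instance
  have hEfin : FiniteDimensional F E := finiteDimensional_adjoin fun x hx => hint x hx
  have hsub (x : L) (hx : x ∈ S) : x ∈ E := subset_adjoin F _ hx
  set S' : Multiset E := S.attach.map fun x => ⟨x.1, hsub x.1 x.2⟩ with hS'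
  have hS'map : S'.map (algebraMap E L) = S := by
    rw [hS', Multiset.map_map]
    exact Multiset.attach_map_val S
  have hS'prod : S'.prod = algebraMap F E u := by
    apply (algebraMap E L).injective
    rw [map_multiset_prod, hS'map, hu, ← IsScalarTower.algebraMap_apply]
  have hroot (x : E) (hx : x ∈ S') : aeval x h = 0 := by
    apply (algebraMap E L).injective
    rw [map_zero, ← aeval_algebraMap_apply]
    exact hS _ (hS'map ▸ Multiset.mem_map_of_mem _ hx)
  have hdeg (x : E) (hx : x ∈ S') : Module.finrank F F⟮x⟯ = h.natDegree := by
    rw [adjoin.finrank (IsIntegral.of_finite F x), ← minpoly.eq_of_irreducible hirr (hroot x hx),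
      natDegree_mul_C (inv_ne_zero (leadingCoeff_ne_zero.mpr hirr.ne_zero))]
  have hdpos : 0 < h.natDegree := by
    obtain ⟨x, hx⟩ := Multiset.exists_mem_of_ne_zero
      (s := S') (by intro h0; rw [h0] at hS'map; exact hne hS'map.symm)
    rw [← hdeg x hx]
    exact Module.finrank_pos
  set e := Module.finrank F E / h.natDegree with he
  have hrank (x : E) (hx : x ∈ S') : Module.finrank F⟮x⟯ E = e := by
    rw [he, ← Module.finrank_mul_finrank F F⟮x⟯ E, hdeg x hx, Nat.mul_div_cancel_left _ hdpos]
  have hrank' : Module.finrank F E = h.natDegree * e ∧ 0 < e := by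
    obtain ⟨x, hx⟩ := Multiset.exists_mem_of_ne_zero
      (s := S') (by intro h0; rw [h0] at hS'map; exact hne hS'map.symm)
    rw [← Module.finrank_mul_finrank F F⟮x⟯ E, hdeg x hx, hrank x hx, ← hrank x hx]
    exact ⟨rfl, Module.finrank_pos⟩
  have hnorm (x : E) (hx : x ∈ S') : Algebra.norm F x =
      ((-1) ^ h.natDegree * (h.coeff 0 / h.leadingCoeff)) ^ e := by
    have hpb := Algebra.PowerBasis.norm_gen_eq_coeff_zero_minpoly
      (adjoin.powerBasis (IsIntegral.of_finite F x))
    rw [adjoin.powerBasis_gen, adjoin.powerBasis_dim, minpoly_gen,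
      ← minpoly.eq_of_irreducible hirr (hroot x hx), coeff_mul_C,
      natDegree_mul_C (inv_ne_zero (leadingCoeff_ne_zero.mpr hirr.ne_zero))] at hpb
    rw [Algebra.norm_eq_norm_adjoin, hpb, hrank x hx, div_eq_mul_inv]
  refine ⟨e, hrank'.2, ?_⟩
  rw [← hrank'.1, ← Algebra.norm_algebraMap, ← hS'prod, map_multiset_prod,
    Multiset.map_congr rfl hnorm, Multiset.map_const', Multiset.prod_replicate, ← pow_mul]
  congr 2
  simp [hS']

open Polynomial in
theorem irreducible_X_pow_sub_C_X_mul_map {K : Type*} [Field K] {g : K[X]} (hg : g.coeff 0 ≠ 0)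
    (k : ℕ) : Irreducible (X ^ k - C X * g.map C : K[X][X]) := by
  have hcop : IsCoprime (-g) (X ^ k) :=
    (IsCoprime.pow_right ((irreducible_X.coprime_iff_not_dvd.mpr
      (by rwa [X_dvd_iff])).symm)).neg_left
  have hirr := irreducible_C_mul_X_add_C (a := -g) (b := X ^ k)
    (by rintro h; apply hg; rw [neg_eq_zero.mp h, coeff_zero]) hcop.isRelPrime
  rw [← MulEquiv.irreducible_iff (Bivariate.swap (R := K))] at hirr
  convert hirr using 1
  rw [map_add, map_mul, Bivariate.swap_C, Bivariate.swap_C, Bivariate.swap_Y]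
  simp
  ring

open Polynomial in
theorem exists_coeff_mul_pow_ne_zero {K : Type*} [Field K] [CharZero K] {g : K[X]} {k : ℕ}
    (hg0 : g.coeff 0 ≠ 0) (hk : 0 < k) (hkn : k < g.natDegree) :
    ∃ m : ℕ, 1 ≤ m ∧ (g ^ m).coeff (k * m) ≠ 0 := by
  by_contra! hg
  set h : K[X][X] := X ^ k - C X * g.map C with hh
  have hirr : Irreducible h := irreducible_X_pow_sub_C_X_mul_map hg0 k
  have hhcoeff (i : ℕ) : h.coeff i = (if i = k then 1 else 0) - X * C (g.coeff i) := by
    simp [hh, coeff_X_pow]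
  have hgn : g.coeff g.natDegree ≠ 0 := by
    rw [coeff_natDegree, leadingCoeff_ne_zero]
    rintro rfl
    simp at hg0
  have hdeg : h.natDegree = g.natDegree := by
    refine natDegree_eq_of_le_of_coeff_ne_zero ?_ ?_
    · rw [natDegree_le_iff_coeff_eq_zero]
      intro i hi
      rw [hhcoeff, if_neg (by omega), coeff_eq_zero_of_natDegree_lt hi]
      simp
    · rw [hhcoeff, if_neg hkn.ne']
      simpa [X_ne_zero] using hgn
  have hlead : h.leadingCoeff = - (X * C (g.coeff g.natDegree)) := by
    rw [leadingCoeff, hdeg, hhcoeff, if_neg hkn.ne', zero_sub]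
  have hcoeff0 : h.coeff 0 = - (X * C (g.coeff 0)) := by
    rw [hhcoeff, if_neg hk.ne, zero_sub]
  have hH : h.map coeToPowerSeries.ringHom =
      X ^ k - C PowerSeries.X * g.map PowerSeries.C := by
    rw [hh, Polynomial.map_sub, Polynomial.map_pow, map_X, Polynomial.map_mul, map_C, map_map]
    congr 3
    · exact coe_X
    · exact RingHom.ext fun c => coe_C c
  obtain ⟨a, b, ha, hadeg, hamap, hbmap, hab⟩ :=
    exists_factorization_of_map_constantCoeff_eq_X_pow
      (F := X ^ k - C PowerSeries.X * g.map PowerSeries.C) (k := k) (by simp)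
  have hb0 : b.coeff 0 = 1 := coeff_zero_eq_one_of_eq_mul hg ha hadeg hamap hbmap hab
  have ha0 : a.coeff 0 = coeToPowerSeries.ringHom (h.coeff 0) := by
    rw [← coeff_map, hH, hab, mul_coeff_zero, hb0, mul_one]
  let L := AlgebraicClosure (FractionRing (PowerSeries K))
  let φ : PowerSeries K →+* L := (algebraMap (FractionRing (PowerSeries K)) L).comp
    (algebraMap (PowerSeries K) (FractionRing (PowerSeries K)))
  have hφ : Function.Injective φ :=
    (algebraMap (FractionRing (PowerSeries K)) L).injective.comp (IsFractionRing.injective _ _)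
  have hφ' : Function.Injective (φ.comp (coeToPowerSeries.ringHom (R := K))) :=
    hφ.comp (Polynomial.coe_injective K)
  let θ : FractionRing K[X] →+* L := IsFractionRing.lift hφ'
  have hθ (p : K[X]) : θ (algebraMap K[X] (FractionRing K[X]) p) =
      φ (coeToPowerSeries.ringHom p) := IsFractionRing.lift_algebraMap hφ' p
  let _ : Algebra (FractionRing K[X]) L := θ.toAlgebra
  have hirr' : Irreducible (h.map (algebraMap K[X] (FractionRing K[X]))) :=
    (hirr.isPrimitive (by omega)).irreducible_iff_irreducible_map_fraction_map.mp hirr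
  have hinj := IsFractionRing.injective K[X] (FractionRing K[X])
  have hsplits : (a.map φ).Splits := IsAlgClosed.splits _
  have hcard : (a.map φ).roots.card = k := by
    rw [← hsplits.natDegree_eq_card_roots, ha.natDegree_map, hadeg]
  have hprod : (a.map φ).roots.prod = algebraMap (FractionRing K[X]) L
      (algebraMap K[X] _ (C ((-1) ^ k * -g.coeff 0) * X)) := by
    have h1 := hsplits.coeff_zero_eq_prod_roots_of_monic (ha.map φ)
    rw [coeff_map, ha0, ha.natDegree_map, hadeg, ← hθ, hcoeff0] at h1
    have h2 : (C ((-1) ^ k * -g.coeff 0) * X : K[X]) = (-1) ^ k * -(X * C (g.coeff 0)) := by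
      simp; ring
    rw [h2]
    change _ = θ _
    rw [map_mul, map_mul, h1, map_pow, map_neg, map_one, map_pow, map_neg, map_one, ← mul_assoc,
      ← mul_pow, neg_mul_neg, one_mul, one_pow, one_mul]
  have hroots (x : L) (hx : x ∈ (a.map φ).roots) :
      aeval x (h.map (algebraMap K[X] (FractionRing K[X]))) = 0 := by
    have hax : eval₂ φ x a = 0 := by
      rw [← eval_map]; exact (mem_roots'.mp hx).2
    rw [aeval_def, eval₂_map]
    have hcomp : (algebraMap (FractionRing K[X]) L).comp (algebraMap K[X] (FractionRing K[X])) =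
        φ.comp coeToPowerSeries.ringHom := RingHom.ext hθ
    rw [hcomp, ← eval₂_map, hH, hab, eval₂_mul, hax, zero_mul]
  obtain ⟨e, he, heq⟩ := exists_pow_eq_pow_of_multiset_prod_eq_algebraMap hirr' hroots hprod
    (by rintro h0; rw [h0, Multiset.card_zero] at hcard; exact hk.ne hcard)
  rw [natDegree_map_eq_of_injective hinj, leadingCoeff_map_of_injective hinj, coeff_map, hdeg,
    hlead, hcoeff0] at heq
  have hratio : algebraMap K[X] (FractionRing K[X]) (-(X * C (g.coeff 0))) /
      algebraMap K[X] (FractionRing K[X]) (-(X * C (g.coeff g.natDegree))) =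
      algebraMap K[X] (FractionRing K[X]) (C (g.coeff 0 / g.coeff g.natDegree)) := by
    rw [div_eq_iff, ← map_mul]
    · congr 1
      rw [mul_neg, mul_left_comm, ← C_mul, div_mul_cancel₀ _ hgn]
    · rw [Ne, map_eq_zero_iff _ hinj]
      simpa [X_ne_zero] using hgn
  rw [hratio, ← map_one (algebraMap K[X] (FractionRing K[X])), ← map_neg, ← map_pow, ← map_pow,
    ← map_mul, ← map_pow] at heq
  have hfinal := congrArg natDegree (hinj heq)
  rw [natDegree_pow, natDegree_C_mul_X _ (by simpa using hg0), natDegree_pow, ← C_1, ← C_neg,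
    ← C_pow, ← C_mul, natDegree_C, mul_zero, mul_one] at hfinal
  have : 0 < g.natDegree * e := Nat.mul_pos (by omega) he
  omega

open Polynomial in
theorem natDegree_lt_or_lt_natTrailingDegree_of_coeff_pow_eq_zero {K : Type*} [Field K]
    [CharZero K] {g : K[X]} {d N : ℕ} (hg : ∀ m : ℕ, N ≤ m → (g ^ m).coeff (d * m) = 0) :
    g = 0 ∨ g.natDegree < d ∨ d < g.natTrailingDegree := by
  by_contra! hcon
  obtain ⟨hne, hdn, hjd⟩ := hcon
  set j := g.natTrailingDegree with hj
  obtain ⟨q, hq⟩ : X ^ j ∣ g := X_pow_dvd_iff.mpr fun i hi =>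
    coeff_eq_zero_of_lt_natTrailingDegree hi
  have hq0 : q.coeff 0 ≠ 0 := by
    have h : g.coeff j ≠ 0 := by
      rw [hj]; exact (coeff_natTrailingDegree_ne_zero.mpr hne)
    rw [hq] at h
    simpa [coeff_X_pow_mul'] using h
  have hqne : q ≠ 0 := by rintro rfl; simp at hq0
  have hdeg : g.natDegree = j + q.natDegree := by
    conv_lhs => rw [hq]
    rw [natDegree_X_pow_mul _ hqne, add_comm]
  obtain ⟨k, rfl⟩ := Nat.exists_eq_add_of_le hjd
  have hqm (m : ℕ) (hm : N ≤ m) : (q ^ m).coeff (k * m) = 0 := by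
    rw [← hg m hm]
    conv_rhs => rw [hq, mul_pow, ← pow_mul, add_mul, add_comm (j * m), coeff_X_pow_mul]
  rcases Nat.eq_zero_or_pos k with rfl | hk
  · have h := hqm N le_rfl
    rw [zero_mul, coeff_zero_eq_eval_zero, eval_pow, ← coeff_zero_eq_eval_zero] at h
    exact pow_ne_zero _ hq0 h
  rcases (show k ≤ q.natDegree by omega).eq_or_lt with hkn | hkn
  · have h := hqm N le_rfl
    rw [hkn, mul_comm, coeff_pow_mul_natDegree] at h
    exact pow_ne_zero _ (leadingCoeff_ne_zero.mpr hqne) h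
  obtain ⟨m, hm, hcoeff⟩ := exists_coeff_mul_pow_ne_zero (g := q ^ (N + 1)) (k := k * (N + 1))
    (by rw [coeff_zero_eq_eval_zero, eval_pow, ← coeff_zero_eq_eval_zero]
        exact pow_ne_zero _ hq0) (by positivity)
    (by rw [natDegree_pow, mul_comm]; exact Nat.mul_lt_mul_of_pos_left hkn (by omega))
  apply hcoeff
  rw [← pow_mul, mul_assoc]
  exact hqm _ (by nlinarith)

open Polynomial in
theorem exists_forall_coeff_pow_mul_eq_zero {K : Type*} [Field K] [CharZero K] {g : K[X]}
    {d N : ℕ} (hg : ∀ m : ℕ, N ≤ m → (g ^ m).coeff (d * m) = 0) (q : K[X]) (e : ℕ) :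
    ∃ M : ℕ, ∀ m : ℕ, M ≤ m → (g ^ m * q).coeff (d * m + e) = 0 := by
  rcases natDegree_lt_or_lt_natTrailingDegree_of_coeff_pow_eq_zero hg with rfl | h | h
  · exact ⟨1, fun m hm => by rw [zero_pow (by omega), zero_mul, coeff_zero]⟩
  · refine ⟨q.natDegree + 1, fun m hm => coeff_eq_zero_of_natDegree_lt ?_⟩
    have h1 : (g ^ m * q).natDegree ≤ m * g.natDegree + q.natDegree :=
      natDegree_mul_le.trans (Nat.add_le_add_right natDegree_pow_le _)
    nlinarith
  · refine ⟨e + 1, fun m hm => ?_⟩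
    have hdvd : X ^ ((d + 1) * m) ∣ g ^ m * q := by
      rw [pow_mul]
      exact (pow_dvd_pow_of_dvd (X_pow_dvd_iff.mpr fun i hi =>
        coeff_eq_zero_of_lt_natTrailingDegree (by omega)) m).mul_right q
    exact X_pow_dvd_iff.mp hdvd _ (by nlinarith)

theorem MvPolynomial.IsHomogeneous.eval_mul_left {σ R : Type*} [Fintype σ] [CommRing R]
    {S : MvPolynomial σ R} {n : ℕ} (hS : S.IsHomogeneous n) (c : R) (x : σ → R) :
    eval (fun i => c * x i) S = c ^ n * eval x S := by
  rw [eval_eq', eval_eq', Finset.mul_sum]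
  refine Finset.sum_congr rfl fun d hd => ?_
  have hdeg : ∑ i, d i = n := by
    rw [← Finsupp.degree_eq_sum, Finsupp.degree_eq_weight_one]
    exact hS (mem_support_iff.mp hd)
  simp_rw [mul_pow]
  rw [Finset.prod_mul_distrib, Finset.prod_pow_eq_pow_sum, hdeg]
  ring

/-- The substitution `x = (z² + 1) / 2`, `y = (z² - 1) / (2i)`: for `|z| = 1` it turns a form of
degree `n` into `zⁿ` times its value at `(re z, im z)`. -/
noncomputable def circleSubstitution : MvPolynomial (Fin 2) ℂ →ₐ[ℂ] Polynomial ℂ :=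
  MvPolynomial.aeval ![Polynomial.C (1 / 2) * (Polynomial.X ^ 2 + 1),
    Polynomial.C (1 / (2 * Complex.I)) * (Polynomial.X ^ 2 - 1)]

theorem eval_circleSubstitution {S : MvPolynomial (Fin 2) ℂ} {n : ℕ} (hS : S.IsHomogeneous n)
    (θ : ℝ) : (circleSubstitution S).eval (Complex.exp (θ * Complex.I)) =
      Complex.exp (θ * Complex.I) ^ n *
        MvPolynomial.eval ![(Real.cos θ : ℂ), (Real.sin θ : ℂ)] S := by
  rw [← hS.eval_mul_left]
  have h : (Polynomial.evalRingHom (Complex.exp (θ * Complex.I))).comp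
      (circleSubstitution : MvPolynomial (Fin 2) ℂ →+* Polynomial ℂ) =
      MvPolynomial.eval fun i => Complex.exp (θ * Complex.I) *
        ![(Real.cos θ : ℂ), (Real.sin θ : ℂ)] i := by
    have hsq : (Real.cos θ : ℂ) ^ 2 + (Real.sin θ : ℂ) ^ 2 = 1 := by
      exact_mod_cast Real.cos_sq_add_sin_sq θ
    have hexp : Complex.exp (θ * Complex.I) = Real.cos θ + Real.sin θ * Complex.I := by
      rw [Complex.exp_mul_I, Complex.ofReal_cos, Complex.ofReal_sin]
    have hI := Complex.I_sq
    apply MvPolynomial.ringHom_ext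
    · intro r
      simp [circleSubstitution]
    · intro i
      fin_cases i
      · simp only [circleSubstitution, RingHom.comp_apply, RingHom.coe_coe, MvPolynomial.aeval_X,
          MvPolynomial.eval_X, Polynomial.coe_evalRingHom, Fin.zero_eta, Matrix.cons_val_zero,
          Polynomial.eval_mul, Polynomial.eval_C, Polynomial.eval_add, Polynomial.eval_pow,
          Polynomial.eval_X, Polynomial.eval_one]
        rw [hexp]
        linear_combination (-1 / 2) * hsq + (1 / 2) * (Real.sin θ : ℂ) ^ 2 * hI
      · simp only [circleSubstitution, RingHom.comp_apply, RingHom.coe_coe, MvPolynomial.aeval_X,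
          MvPolynomial.eval_X, Polynomial.coe_evalRingHom, Fin.mk_one, Matrix.cons_val_one,
          Matrix.cons_val_zero, Polynomial.eval_mul, Polynomial.eval_C, Polynomial.eval_sub,
          Polynomial.eval_pow, Polynomial.eval_X, Polynomial.eval_one]
        rw [hexp]
        have hI0 := Complex.I_ne_zero
        field_simp
        linear_combination hsq - (Real.sin θ : ℂ) ^ 2 * hI
  exact congrArg (fun φ => φ S) h

theorem integral_exp_mul_eval_exp (p : Polynomial ℂ) (n : ℕ) :
    ∫ θ in Set.Ioo (-Real.pi) Real.pi, Complex.exp (-(n * θ * Complex.I)) *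
      p.eval (Complex.exp (θ * Complex.I)) = 2 * Real.pi * p.coeff n := by
  have hle : -Real.pi ≤ Real.pi := by linarith [Real.pi_pos]
  rw [← integral_Ioc_eq_integral_Ioo, ← intervalIntegral.integral_of_le hle]
  induction p using Polynomial.induction_on' with
  | add p q hp hq =>
    simp only [Polynomial.eval_add, mul_add, Polynomial.coeff_add]
    rw [intervalIntegral.integral_add, hp, hq]
    all_goals
      apply Continuous.intervalIntegrable
      have := Polynomial.continuous p
      have := Polynomial.continuous q
      fun_prop
  | monomial j c =>
    have hterm (θ : ℝ) : Complex.exp (-(n * θ * Complex.I)) *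
        (Polynomial.monomial j c).eval (Complex.exp (θ * Complex.I)) =
        c * Complex.exp ((((j : ℂ) - n) * Complex.I) * θ) := by
      rw [Polynomial.eval_monomial, ← Complex.exp_nat_mul, mul_left_comm, ← Complex.exp_add]
      ring_nf
    simp_rw [hterm]
    rw [intervalIntegral.integral_const_mul, Polynomial.coeff_monomial]
    split_ifs with hjn
    · subst hjn
      simp
      ring
    · have hne : (((j : ℂ) - n) * Complex.I) ≠ 0 :=
        mul_ne_zero (sub_ne_zero.mpr (by exact_mod_cast hjn)) Complex.I_ne_zero
      rw [integral_exp_mul_complex hne, mul_zero]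
      have hper : Complex.exp (((j : ℂ) - n) * Complex.I * Real.pi) =
          Complex.exp (((j : ℂ) - n) * Complex.I * (-Real.pi : ℝ)) := by
        rw [Complex.exp_eq_exp_iff_exists_int]
        exact ⟨j - n, by push_cast; ring⟩
      rw [hper, sub_self, zero_div, mul_zero]

theorem integral_disk_eval_of_isHomogeneous {S : MvPolynomial (Fin 2) ℂ} {n : ℕ}
    (hS : S.IsHomogeneous n) :
    ∫ p : ℝ × ℝ in {p : ℝ × ℝ | p.1 ^ 2 + p.2 ^ 2 ≤ 1},
      MvPolynomial.eval ![(p.1 : ℂ), (p.2 : ℂ)] S =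
      2 * Real.pi / (n + 2) * (circleSubstitution S).coeff n := by
  have hmeas : MeasurableSet {p : ℝ × ℝ | p.1 ^ 2 + p.2 ^ 2 ≤ 1} :=
    (isClosed_le (by fun_prop) (by fun_prop)).measurableSet
  rw [← integral_indicator hmeas, ← integral_comp_polarCoord_symm]
  have htarget : polarCoord.target = Set.Ioi (0 : ℝ) ×ˢ Set.Ioo (-Real.pi) Real.pi := rfl
  rw [htarget]
  have hcongr : ∀ p ∈ Set.Ioi (0 : ℝ) ×ˢ Set.Ioo (-Real.pi) Real.pi,
      p.1 • Set.indicator {p : ℝ × ℝ | p.1 ^ 2 + p.2 ^ 2 ≤ 1}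
        (fun p : ℝ × ℝ => MvPolynomial.eval ![(p.1 : ℂ), (p.2 : ℂ)] S) (polarCoord.symm p) =
      Set.indicator (Set.Iic 1) (fun r : ℝ => (r : ℂ) ^ (n + 1)) p.1 *
        (Complex.exp (-(n * p.2 * Complex.I)) *
          (circleSubstitution S).eval (Complex.exp (p.2 * Complex.I))) := by
    rintro ⟨r, θ⟩ ⟨hr, -⟩
    have hr0 : 0 < r := hr
    have hsymm : polarCoord.symm (r, θ) = (r * Real.cos θ, r * Real.sin θ) := rfl
    have hnorm : (r * Real.cos θ) ^ 2 + (r * Real.sin θ) ^ 2 = r ^ 2 := by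
      linear_combination r ^ 2 * Real.cos_sq_add_sin_sq θ
    rw [hsymm]
    by_cases hr1 : r ≤ 1
    · rw [Set.indicator_of_mem (by
          rw [Set.mem_ofPred_eq, hnorm]
          exact pow_le_one₀ hr0.le hr1), Set.indicator_of_mem (by exact hr1),
        eval_circleSubstitution hS, ← mul_assoc (Complex.exp _), ← Complex.exp_nat_mul,
        ← Complex.exp_add]
      have hvec : ![((r * Real.cos θ : ℝ) : ℂ), ((r * Real.sin θ : ℝ) : ℂ)] =
          fun i => (r : ℂ) * ![(Real.cos θ : ℂ), (Real.sin θ : ℂ)] i := by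
        funext i
        fin_cases i <;> simp
      have hzero : -(n * (θ : ℂ) * Complex.I) + n * (θ * Complex.I) = 0 := by ring
      dsimp only
      rw [hvec, hS.eval_mul_left, hzero, Complex.exp_zero, one_mul, Complex.real_smul]
      ring
    · rw [Set.indicator_of_notMem (by
          rw [Set.mem_ofPred_eq, hnorm]
          nlinarith), Set.indicator_of_notMem (by exact hr1), smul_zero, zero_mul]
  rw [setIntegral_congr_fun (measurableSet_Ioi.prod measurableSet_Ioo) hcongr,
    Measure.volume_eq_prod, setIntegral_prod_mul
      (Set.indicator (Set.Iic 1) (fun r : ℝ => (r : ℂ) ^ (n + 1)))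
      (fun θ : ℝ => Complex.exp (-(n * θ * Complex.I)) *
          (circleSubstitution S).eval (Complex.exp (θ * Complex.I))),
    integral_exp_mul_eval_exp, setIntegral_indicator measurableSet_Iic, Set.Ioi_inter_Iic,
    ← intervalIntegral.integral_of_le zero_le_one]
  have hrad : ∫ r in (0 : ℝ)..1, (r : ℂ) ^ (n + 1) = 1 / (n + 2) := by
    have h := integral_pow (a := 0) (b := 1) (n + 1)
    simp_rw [← Complex.ofReal_pow]
    rw [intervalIntegral.integral_ofReal, h]
    push_cast
    simp
    ring
  rw [hrad]
  ring

theorem integrableOn_disk_eval (S : MvPolynomial (Fin 2) ℂ) :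
    IntegrableOn (fun p : ℝ × ℝ => MvPolynomial.eval ![(p.1 : ℂ), (p.2 : ℂ)] S)
      {p : ℝ × ℝ | p.1 ^ 2 + p.2 ^ 2 ≤ 1} := by
  have hclosed : IsClosed {p : ℝ × ℝ | p.1 ^ 2 + p.2 ^ 2 ≤ 1} :=
    isClosed_le (by fun_prop) (by fun_prop)
  have hsubset : {p : ℝ × ℝ | p.1 ^ 2 + p.2 ^ 2 ≤ 1} ⊆ Set.Icc (-1) 1 ×ˢ Set.Icc (-1) 1 := by
    rintro ⟨x, y⟩ h
    simp only [Set.mem_ofPred_eq] at h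
    refine ⟨⟨?_, ?_⟩, ?_, ?_⟩ <;> dsimp only <;> nlinarith [sq_nonneg x, sq_nonneg y]
  refine ContinuousOn.integrableOn_compact
    ((isCompact_Icc.prod isCompact_Icc).of_isClosed_subset hclosed hsubset) ?_
  apply Continuous.continuousOn
  refine (MvPolynomial.continuous_eval S).comp (continuous_pi fun i => ?_)
  fin_cases i
  · exact Complex.continuous_ofReal.comp continuous_fst
  · exact Complex.continuous_ofReal.comp continuous_snd

/-- if `P ∈ ℂ[x,y]` is homogeneous and `∫_B P^m = 0` for all
sufficiently large `m`, where `B` is the closed unit disk with Lebesgue measure,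
then for every `Q ∈ ℂ[x,y]` one has `∫_B P^m Q = 0` for all sufficiently large `m`. -/
theorem unit_disk_homogeneous_moments (P : MvPolynomial (Fin 2) ℂ)
    (hhom : ∃ d : ℕ, P.IsHomogeneous d)
    (hP : ∃ N : ℕ, ∀ m : ℕ, N ≤ m →
      (∫ p : ℝ × ℝ in {p : ℝ × ℝ | p.1 ^ 2 + p.2 ^ 2 ≤ 1},
        MvPolynomial.eval ![(p.1 : ℂ), (p.2 : ℂ)] P ^ m) = 0) :
    ∀ Q : MvPolynomial (Fin 2) ℂ, ∃ N : ℕ, ∀ m : ℕ, N ≤ m →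
      (∫ p : ℝ × ℝ in {p : ℝ × ℝ | p.1 ^ 2 + p.2 ^ 2 ≤ 1},
        MvPolynomial.eval ![(p.1 : ℂ), (p.2 : ℂ)] P ^ m *
          MvPolynomial.eval ![(p.1 : ℂ), (p.2 : ℂ)] Q) = 0 := by
  obtain ⟨d, hd⟩ := hhom
  obtain ⟨N, hN⟩ := hP
  simp_rw [← map_pow] at hN
  simp_rw [← map_pow, ← map_mul]
  have hg : ∀ m, N ≤ m → (circleSubstitution P ^ m).coeff (d * m) = 0 := by
    intro m hm
    have hfactor : 2 * (Real.pi : ℂ) / ((d * m : ℕ) + 2) ≠ 0 :=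
      div_ne_zero (by simp [Real.pi_ne_zero]) (by exact_mod_cast Nat.succ_ne_zero (d * m + 1))
    have h := hN m hm
    rw [integral_disk_eval_of_isHomogeneous (hd.pow m)] at h
    rw [← map_pow]
    exact (mul_eq_zero.mp h).resolve_left hfactor
  intro Q
  induction Q using MvPolynomial.induction_on' with
  | monomial u a =>
    obtain ⟨M, hM⟩ := exists_forall_coeff_pow_mul_eq_zero hg
      (circleSubstitution (MvPolynomial.monomial u a)) u.degree
    refine ⟨M, fun m hm => ?_⟩
    rw [integral_disk_eval_of_isHomogeneous
      ((hd.pow m).mul (MvPolynomial.isHomogeneous_monomial a rfl)), map_mul, map_pow, hM m hm,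
      mul_zero]
  | add p q hp hq =>
    obtain ⟨M₁, h₁⟩ := hp
    obtain ⟨M₂, h₂⟩ := hq
    refine ⟨max M₁ M₂, fun m hm => ?_⟩
    simp_rw [mul_add, map_add]
    rw [integral_add (integrableOn_disk_eval _) (integrableOn_disk_eval _),
      h₁ m (le_of_max_le_left hm), h₂ m (le_of_max_le_right hm), add_zero]
end

section
/- Let F ∈ ℂ[x₁,…,xₙ] be a polynomial with F(0) ≠ 0 (nonzero constant term). Then E(Fᵐ) ≠ 0 for infinitely many integers m ≥ 1, where E denotes the Gaussian expectation with respect to γₙ. -/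
open MeasureTheory ProbabilityTheory

/-- The Gaussian expectation of a complex polynomial in the variables indexed by `σ`,
with respect to the standard Gaussian measure (product of `N(0,1)`'s). -/
noncomputable def gaussExp {σ : Type*} [Fintype σ] (P : MvPolynomial σ ℂ) : ℂ :=
  ∫ x : σ → ℝ, MvPolynomial.eval (fun i => (x i : ℂ)) P
    ∂(Measure.pi fun _ : σ => gaussianReal 0 1)

/-- The moments of the standard normal distribution, as natural numbers. -/
def gaussMoment : ℕ → ℕ
  | 0 => 1
  | 1 => 0
  | k + 2 => (k + 1) * gaussMoment k

lemma gaussMoment_of_odd {k : ℕ} (hk : Odd k) : gaussMoment k = 0 := by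
  obtain ⟨j, rfl⟩ := hk
  induction j with
  | zero => rfl
  | succ j ih =>
    rw [show 2 * (j + 1) + 1 = (2 * j + 1) + 2 by ring, gaussMoment, ih, mul_zero]

lemma dvd_gaussMoment_of_le {p : ℕ} (hp : Odd p) {k : ℕ} (hk : p ≤ k) :
    p ∣ gaussMoment k := by
  obtain ⟨j, rfl⟩ := Nat.exists_eq_add_of_le hk
  clear hk
  induction j using Nat.twoStepInduction with
  | zero => simp [gaussMoment_of_odd hp]
  | one =>
    obtain ⟨i, rfl⟩ := hp
    exact Dvd.intro _ rfl
  | more j ih _ => exact ih.mul_left _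

/-- The linear functional sending a monomial to the product of the Gaussian moments
of its exponents, over an arbitrary commutative ring. -/
noncomputable def momentFunctional (σ R : Type*) [Fintype σ] [CommRing R] :
    MvPolynomial σ R →ₗ[R] R :=
  (MvPolynomial.basisMonomials σ R).constr R fun α => ∏ i, (gaussMoment (α i) : R)

lemma momentFunctional_monomial {σ R : Type*} [Fintype σ] [CommRing R] (α : σ →₀ ℕ) (c : R) :
    momentFunctional σ R (MvPolynomial.monomial α c) = c * ∏ i, (gaussMoment (α i) : R) := by
  have h : MvPolynomial.monomial α c = c • MvPolynomial.basisMonomials σ R α := by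
    simp [MvPolynomial.smul_monomial]
  rw [h, map_smul, momentFunctional, Module.Basis.constr_basis, smul_eq_mul]

lemma momentFunctional_map {σ R S : Type*} [Fintype σ] [CommRing R] [CommRing S] (f : R →+* S)
    (P : MvPolynomial σ R) :
    momentFunctional σ S (MvPolynomial.map f P) = f (momentFunctional σ R P) := by
  induction P using MvPolynomial.induction_on' with
  | monomial α c => simp [MvPolynomial.map_monomial, momentFunctional_monomial]
  | add P Q hP hQ => simp [hP, hQ]

/-- In odd characteristic `p`, the functional sees only the constant term of a `p`-th power. -/
lemma momentFunctional_pow_char {σ R : Type*} [Fintype σ] [CommRing R] (p : ℕ) [Fact p.Prime]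
    [CharP R p] (hp : Odd p) (P : MvPolynomial σ R) :
    momentFunctional σ R (P ^ p) = MvPolynomial.constantCoeff P ^ p := by
  classical
  induction P using MvPolynomial.induction_on' with
  | monomial α c =>
    rw [MvPolynomial.monomial_pow, momentFunctional_monomial, MvPolynomial.constantCoeff_monomial]
    split_ifs with h
    · simp [h, gaussMoment]
    · obtain ⟨i, hi⟩ := Finsupp.ne_iff.mp h
      have hdvd : p ∣ gaussMoment ((p • α) i) := by
        refine dvd_gaussMoment_of_le hp ?_
        simpa using Nat.le_mul_of_pos_right p (Nat.pos_of_ne_zero hi)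
      rw [Finset.prod_eq_zero (Finset.mem_univ i) ((CharP.cast_eq_zero_iff R p _).mpr hdvd),
        mul_zero, zero_pow (Fact.out : p.Prime).ne_zero]
  | add P Q hP hQ =>
    rw [add_pow_char, map_add, hP, hQ, map_add, add_pow_char]

lemma integrable_pow_gaussianReal (k : ℕ) :
    Integrable (fun x : ℝ => x ^ k) (gaussianReal 0 1) := by
  rw [← integrable_norm_iff (by fun_prop)]
  simpa [norm_pow] using (memLp_id_gaussianReal (μ := 0) (v := 1) k).integrable_norm_pow'

lemma integrable_gaussianPDFReal_mul_pow (k : ℕ) :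
    Integrable (fun x : ℝ => gaussianPDFReal 0 1 x * x ^ k) := by
  have h := integrable_pow_gaussianReal k
  rw [gaussianReal_of_var_ne_zero _ one_ne_zero, integrable_withDensity_iff_integrable_smul'
    (measurable_gaussianPDF _ _) (ae_of_all _ fun _ => gaussianPDF_lt_top)] at h
  simpa [smul_eq_mul] using h

lemma hasDerivAt_gaussianPDFReal (x : ℝ) :
    HasDerivAt (gaussianPDFReal 0 1) (-x * gaussianPDFReal 0 1 x) x := by
  rw [gaussianPDFReal_def]
  have h : HasDerivAt (fun y : ℝ => -(y - 0) ^ 2 / (2 * ((1 : NNReal) : ℝ))) (-x) x := by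
    have := ((((hasDerivAt_id x).sub_const 0).pow 2).neg).div_const (2 * ((1 : NNReal) : ℝ))
    convert! this using 1
    norm_num
    ring
  convert! h.exp.const_mul (√(2 * Real.pi * ((1 : NNReal) : ℝ)))⁻¹ using 1
  ring

lemma integral_pow_gaussianReal (k : ℕ) :
    ∫ x : ℝ, x ^ k ∂(gaussianReal 0 1) = gaussMoment k := by
  induction k using Nat.twoStepInduction with
  | zero => simp [gaussMoment]
  | one => simp [gaussMoment, integral_id_gaussianReal]
  | more k ih _ =>
    rw [integral_gaussianReal_eq_integral_smul one_ne_zero] at ih ⊢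
    simp only [smul_eq_mul] at ih ⊢
    have hderiv (x : ℝ) : HasDerivAt (fun x => gaussianPDFReal 0 1 x * x ^ (k + 1))
        ((k + 1 : ℝ) * (gaussianPDFReal 0 1 x * x ^ k) -
          gaussianPDFReal 0 1 x * x ^ (k + 2)) x := by
      convert! (hasDerivAt_gaussianPDFReal x).mul (hasDerivAt_pow (k + 1) x) using 1
      push_cast [Nat.add_sub_cancel]
      ring
    have h₁ := (integrable_gaussianPDFReal_mul_pow k).const_mul (k + 1 : ℝ)
    have h₂ := integrable_gaussianPDFReal_mul_pow (k + 2)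
    have h := integral_eq_zero_of_hasDerivAt_of_integrable hderiv (h₁.sub h₂)
      (integrable_gaussianPDFReal_mul_pow (k + 1))
    rw [integral_sub h₁ h₂, integral_const_mul, ih] at h
    rw [gaussMoment]
    push_cast
    linarith

lemma gaussExp_eq_momentFunctional {σ : Type*} [Fintype σ] (P : MvPolynomial σ ℂ) :
    gaussExp P = momentFunctional σ ℂ P := by
  suffices h : Integrable (fun x : σ → ℝ => MvPolynomial.eval (fun i => (x i : ℂ)) P)
      (Measure.pi fun _ : σ => gaussianReal 0 1) ∧ gaussExp P = momentFunctional σ ℂ P from h.2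
  induction P using MvPolynomial.induction_on' with
  | monomial α c =>
    have heval (x : σ → ℝ) : MvPolynomial.eval (fun i => (x i : ℂ)) (MvPolynomial.monomial α c) =
        c * ∏ i, ((x i ^ α i : ℝ) : ℂ) := by
      simp [MvPolynomial.eval_monomial, Finsupp.prod_fintype]
    constructor
    · simp_rw [heval]
      exact (Integrable.fintype_prod (f := fun i (y : ℝ) => ((y ^ α i : ℝ) : ℂ))
        fun i => (integrable_pow_gaussianReal (α i)).ofReal).const_mul c
    · simp_rw [gaussExp, heval]
      rw [integral_const_mul,
        integral_fintype_prod_eq_prod (f := fun i (y : ℝ) => ((y ^ α i : ℝ) : ℂ)),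
        momentFunctional_monomial]
      simp_rw [integral_complex_ofReal, integral_pow_gaussianReal]
      simp
  | add P Q hP hQ =>
    refine ⟨by simp_rw [map_add]; exact hP.1.add hQ.1, ?_⟩
    rw [map_add, ← hP.2, ← hQ.2]
    simp_rw [gaussExp, map_add]
    exact integral_add hP.1 hQ.1

lemma isJacobsonRing_int : IsJacobsonRing ℤ := by
  refine isJacobsonRing_iff_prime_eq.mpr fun P hP => ?_
  rcases eq_or_ne P ⊥ with rfl | hbot
  · refine eq_bot_iff.mpr fun x hx => ?_
    have h := Int.isUnit_iff.mp (Ideal.mem_jacobson_bot.mp hx x)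
    rw [Ideal.mem_bot]
    rcases h with h | h
    · exact mul_self_eq_zero.mp (by linarith)
    · nlinarith [mul_self_nonneg x]
  · have := hP.isMaximal hbot
    exact Ideal.jacobson_eq_self_of_isMaximal

/-- A field that is finitely generated as a ring has positive characteristic. -/
lemma not_charZero_of_finiteType_int (K : Type*) [Field K] [Algebra ℤ K]
    [Algebra.FiniteType ℤ K] :
    ¬ CharZero K := fun _ => by
  have := isJacobsonRing_int
  have := finite_of_finite_type_of_isJacobsonRing ℤ K
  exact Int.not_isField (isField_of_isIntegral_of_isField
    (RingHom.injective_int _) (Field.toIsField K))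

/-- if `F ∈ ℂ[x₁,…,xₙ]` has nonzero constant term `F(0) ≠ 0`, then
`E(F^m) ≠ 0` for infinitely many `m ≥ 1`. -/
theorem gaussian_moments_ne_zero_of_constantCoeff_ne_zero (n : ℕ)
    (F : MvPolynomial (Fin n) ℂ) (hF : MvPolynomial.constantCoeff F ≠ 0) :
    {m : ℕ | 1 ≤ m ∧ gaussExp (F ^ m) ≠ 0}.Infinite := by
  classical
  intro hfin
  obtain ⟨N, hN⟩ := hfin.bddAbove
  set d : ℂ := ((N + 2).factorial : ℂ)
  have hd0 : d ≠ 0 := Nat.cast_ne_zero.mpr (Nat.factorial_ne_zero _)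
  let s : Finset ℂ := F.coeffs ∪ {(MvPolynomial.constantCoeff F)⁻¹, d⁻¹}
  let R := Algebra.adjoin ℤ (s : Set ℂ)
  have : Algebra.FiniteType ℤ R := Subalgebra.fg_iff_finiteType R |>.mp ⟨s, rfl⟩
  have hs {z : ℂ} (hz : z ∈ s) : z ∈ R := Algebra.subset_adjoin hz
  obtain ⟨G, hG⟩ : F ∈ Set.range (MvPolynomial.map (algebraMap R ℂ)) := by
    rw [MvPolynomial.mem_range_map_iff_coeffs_subset]
    intro z hz
    exact ⟨⟨z, hs (Finset.mem_union_left _ hz)⟩, rfl⟩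
  have hinj : Function.Injective (algebraMap R ℂ) := Subtype.val_injective
  have hG0 : algebraMap R ℂ (MvPolynomial.constantCoeff G) = MvPolynomial.constantCoeff F := by
    rw [← hG, MvPolynomial.constantCoeff_map]
  have hGunit : IsUnit (MvPolynomial.constantCoeff G) :=
    IsUnit.of_mul_eq_one ⟨_, hs (z := (MvPolynomial.constantCoeff F)⁻¹) (by simp [s])⟩ <|
      hinj (by rw [map_mul, hG0, map_one]; exact mul_inv_cancel₀ hF)
  have hdunit : IsUnit ((N + 2).factorial : R) :=
    IsUnit.of_mul_eq_one ⟨_, hs (z := d⁻¹) (by simp [s])⟩ <|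
      hinj (by rw [map_mul, map_natCast, map_one]; exact mul_inv_cancel₀ hd0)
  obtain ⟨I, hI⟩ := Ideal.exists_maximal R
  let := Ideal.Quotient.field I
  have hK : Algebra.FiniteType ℤ (R ⧸ I) := inferInstance
  obtain ⟨p, hp⟩ := CharP.exists (R ⧸ I)
  rcases CharP.char_is_prime_or_zero (R ⧸ I) p with hprime | rfl
  · have := Fact.mk hprime
    have hlt : N + 2 < p := by
      by_contra! hle
      have h := (hdunit.map (Ideal.Quotient.mk I)).ne_zero
      rw [map_natCast] at h
      exact h ((CharP.cast_eq_zero_iff _ p _).mpr (hprime.dvd_factorial.mpr hle))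
    have hzero : gaussExp (F ^ p) = 0 := by
      by_contra h
      have := hN ⟨hprime.one_le, h⟩
      omega
    rw [gaussExp_eq_momentFunctional, ← hG, ← map_pow, momentFunctional_map,
      map_eq_zero_iff _ hinj] at hzero
    have h := momentFunctional_pow_char p (hprime.odd_of_ne_two (by omega))
      (MvPolynomial.map (Ideal.Quotient.mk I) G)
    rw [← map_pow, momentFunctional_map, hzero, map_zero, MvPolynomial.constantCoeff_map] at h
    exact pow_ne_zero p (hGunit.map (Ideal.Quotient.mk I)).ne_zero h.symm
  · exact not_charZero_of_finiteType_int (R ⧸ I) (CharP.charP_to_charZero _)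
end
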